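/- Let G = (V, E) be a finite undirected graph, with a fixed linear order < on V, in which every vertex is incident to at least one edge, and let M be the DFA constructed from G as described. Then there exists a DFA N with at most 14 states such that |L(M) △ L(N)| ≤ |E| · (|V| − 2) if and only if G is 3-colourable. -/

import Mathlib

/-- The alphabet `Σ = {a, b} ∪ V ∪ E` of the DFA constructed from the graph
`G = (V, E)` (edges are represented as ordered pairs `(v₁, v₂)` with `v₁ < v₂`). -/
inductive Al (V : Type) (E : Finset (V × V)) : Type where
  | a : Al V E
  | b : Al V E
  | vert : V → Al V E
  | edge : {p : V × V // p ∈ E} → Al V E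

/-- The state set `Q = {⊤, ⊥, ∞, ☺, ☹} ∪ V ∪ {☺_j, ◐_j, ☹_j : j ∈ {1,2,3}}`
(the index `j ∈ {1,2,3}` is represented by `Fin 3`, with `0, 1, 2` standing
for `1, 2, 3`). -/
inductive St (V : Type) : Type where
  | top : St V          -- ⊤
  | bot : St V          -- ⊥
  | inf : St V          -- ∞
  | smile : St V        -- ☺
  | frown : St V        -- ☹
  | vert : V → St V
  | smileJ : Fin 3 → St V   -- ☺_j
  | halfJ : Fin 3 → St V    -- ◐_j
  | frownJ : Fin 3 → St V   -- ☹_j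
  deriving DecidableEq

/-- The transition function `δ` of the DFA `M` constructed from the graph. -/
def Mstep {V : Type} [DecidableEq V] {E : Finset (V × V)} : St V → Al V E → St V
  | .top, .vert v => .vert v
  | .inf, .a => .smileJ 0
  | .inf, .b => .frownJ 0
  | .vert v, .edge e =>
      if v = e.val.1 then .smileJ 0
      else if v = e.val.2 then .frownJ 0
      else .halfJ 0
  | .halfJ j, .a => if j = 0 then .halfJ 1 else if j = 1 then .halfJ 2 else .smile
  | .halfJ j, .b => if j = 2 then .frown else .bot
  | .smileJ j, .a => if j = 0 then .smileJ 1 else if j = 1 then .smileJ 2 else .smile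
  | .smileJ j, .b => if j = 2 then .smile else .bot
  | .frownJ j, .a => if j = 0 then .frownJ 1 else if j = 1 then .frownJ 2 else .frown
  | .frownJ j, .b => if j = 2 then .frown else .bot
  | .smile, .b => .inf
  | .frown, .b => .inf
  | _, _ => .bot

/-- The total DFA `M` constructed from the graph `G = (V, E)`, with start state `⊤`
and accepting states `F = {∞, ☺}`. -/
def MD (V : Type) [DecidableEq V] (E : Finset (V × V)) : DFA (Al V E) (St V) where
  step := Mstep
  start := .top
  accept := {.inf, .smile}


/-- States of the 14-state automaton built from a 3-colouring. -/
inductive NS : Type where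
  | top : NS
  | bot : NS
  | inf : NS
  | smile : NS
  | frown : NS
  | col : Fin 3 → NS
  | smileJ : Fin 3 → NS
  | frownJ : Fin 3 → NS
  deriving DecidableEq, Fintype

theorem card_NS : Fintype.card NS = 14 := by decide

def Nstep {V : Type} {E : Finset (V × V)} (c : V → Fin 3) : NS → Al V E → NS
  | .top, .vert v => .col (c v)
  | .inf, .a => .smileJ 0
  | .inf, .b => .frownJ 0
  | .col k, .edge e =>
      if k = c e.val.1 then .smileJ 0
      else if k = c e.val.2 then .frownJ 0
      else .smileJ 0
  | .smileJ j, .a => if j = 0 then .smileJ 1 else if j = 1 then .smileJ 2 else .smile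
  | .smileJ j, .b => if j = 2 then .smile else .bot
  | .frownJ j, .a => if j = 0 then .frownJ 1 else if j = 1 then .frownJ 2 else .frown
  | .frownJ j, .b => if j = 2 then .frown else .bot
  | .smile, .b => .inf
  | .frown, .b => .inf
  | _, _ => .bot

def ND {V : Type} (E : Finset (V × V)) (c : V → Fin 3) : DFA (Al V E) NS where
  step := Nstep c
  start := .top
  accept := {.inf, .smile}

/-- kernel states of the small automaton together with their counterparts. -/
inductive KR (V : Type) : NS → St V → Prop
  | bot : KR V .bot .bot
  | inf : KR V .inf .inf
  | smile : KR V .smile .smile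
  | frown : KR V .frown .frown
  | smileJ (j : Fin 3) : KR V (.smileJ j) (.smileJ j)
  | frownJ (j : Fin 3) : KR V (.frownJ j) (.frownJ j)

theorem KR.step {V : Type} [DecidableEq V] {E : Finset (V × V)} (c : V → Fin 3)
    {s : NS} {t : St V} (h : KR V s t) (x : Al V E) : KR V (Nstep c s x) (Mstep t x) := by
  cases h <;> cases x <;> simp only [Nstep, Mstep] <;> (repeat' split_ifs) <;> constructor

/-- acceptance from a state of the big automaton -/
def MA {V : Type} [DecidableEq V] {E : Finset (V × V)} (t : St V) (w : List (Al V E)) : Prop :=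
  w ∈ (MD V E).acceptsFrom t

def NA {V : Type} {E : Finset (V × V)} (c : V → Fin 3) (s : NS) (w : List (Al V E)) : Prop :=
  w ∈ (ND E c).acceptsFrom s

theorem MA_nil {V : Type} [DecidableEq V] {E : Finset (V × V)} (t : St V) :
    MA (E := E) t [] ↔ t = .inf ∨ t = .smile := Iff.rfl

theorem MA_cons {V : Type} [DecidableEq V] {E : Finset (V × V)} (t : St V) (x : Al V E)
    (w : List (Al V E)) : MA t (x :: w) ↔ MA (Mstep t x) w := Iff.rfl

theorem NA_nil {V : Type} {E : Finset (V × V)} (c : V → Fin 3) (s : NS) :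
    NA (E := E) c s [] ↔ s = .inf ∨ s = .smile := Iff.rfl

theorem NA_cons {V : Type} {E : Finset (V × V)} (c : V → Fin 3) (s : NS) (x : Al V E)
    (w : List (Al V E)) : NA c s (x :: w) ↔ NA c (Nstep c s x) w := Iff.rfl

theorem KR.iff {V : Type} [DecidableEq V] {E : Finset (V × V)} (c : V → Fin 3)
    (w : List (Al V E)) : ∀ {s : NS} {t : St V}, KR V s t → (MA t w ↔ NA c s w) := by
  induction w with
  | nil => intro s t h; cases h <;> simp [MA_nil, NA_nil]
  | cons x w ih => intro s t h; rw [MA_cons, NA_cons]; exact ih (h.step c x)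

/-- half versus smile -/
theorem half_smile {V : Type} [DecidableEq V] {E : Finset (V × V)} (c : V → Fin 3)
    (w : List (Al V E)) (hw : w ≠ [.a, .a, .b]) :
    MA (.halfJ 0) w ↔ NA c (.smileJ 0) w := by
  have kb := fun w => KR.iff (E := E) c w KR.bot
  have ki := fun w => KR.iff (E := E) c w KR.inf
  have ks := fun w => KR.iff (E := E) c w KR.smile
  rcases w with _ | ⟨x, w⟩
  · simp [MA_nil, NA_nil]
  rcases x with _ | _ | _ | _ <;> simp [MA_cons, NA_cons, Mstep, Nstep, kb]
  rcases w with _ | ⟨x, w⟩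
  · simp [MA_nil, NA_nil]
  rcases x with _ | _ | _ | _ <;> simp [MA_cons, NA_cons, Mstep, Nstep, kb]
  rcases w with _ | ⟨x, w⟩
  · simp [MA_nil, NA_nil]
  rcases x with _ | _ | _ | _ <;> simp [MA_cons, NA_cons, Mstep, Nstep, kb, ks]
  rcases w with _ | ⟨x, w⟩
  · simp at hw
  rcases x with _ | _ | _ | _ <;> simp [MA_cons, NA_cons, Mstep, Nstep, kb, ki]

/-- half versus frown -/
theorem half_frown {V : Type} [DecidableEq V] {E : Finset (V × V)} (c : V → Fin 3)
    (w : List (Al V E)) (hw : w ≠ [.a, .a, .a]) :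
    MA (.halfJ 0) w ↔ NA c (.frownJ 0) w := by
  have kb := fun w => KR.iff (E := E) c w KR.bot
  have ki := fun w => KR.iff (E := E) c w KR.inf
  have kf := fun w => KR.iff (E := E) c w KR.frown
  rcases w with _ | ⟨x, w⟩
  · simp [MA_nil, NA_nil]
  rcases x with _ | _ | _ | _ <;> simp [MA_cons, NA_cons, Mstep, Nstep, kb]
  rcases w with _ | ⟨x, w⟩
  · simp [MA_nil, NA_nil]
  rcases x with _ | _ | _ | _ <;> simp [MA_cons, NA_cons, Mstep, Nstep, kb]
  rcases w with _ | ⟨x, w⟩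
  · simp [MA_nil, NA_nil]
  rcases x with _ | _ | _ | _ <;> simp [MA_cons, NA_cons, Mstep, Nstep, kb, kf]
  rcases w with _ | ⟨x, w⟩
  · simp at hw
  rcases x with _ | _ | _ | _ <;> simp [MA_cons, NA_cons, Mstep, Nstep, kb, ki]

/-- Non-incident vertex-edge pairs. -/
def PP {V : Type} [Fintype V] [DecidableEq V] (E : Finset (V × V)) :
    Finset ((_ : {p : V × V // p ∈ E}) × V) :=
  Finset.univ.sigma fun e => Finset.univ \ {e.val.1, e.val.2}

theorem card_PP {V : Type} [Fintype V] [LinearOrder V] (E : Finset (V × V))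
    (hord : ∀ e ∈ E, e.1 < e.2) : (PP E).card = E.card * (Fintype.card V - 2) := by
  rw [PP, Finset.card_sigma]
  rw [Finset.sum_congr rfl (g := fun _ => Fintype.card V - 2)]
  · simp
  · intro e _
    rw [Finset.card_sdiff_of_subset (Finset.subset_univ _),
      Finset.card_pair (hord _ e.2).ne, Finset.card_univ]

theorem forward {V : Type} [Fintype V] [LinearOrder V] (E : Finset (V × V))
    (hord : ∀ e ∈ E, e.1 < e.2) (c : V → Fin 3) (hc : ∀ e ∈ E, c e.1 ≠ c e.2) :
    (symmDiff ((MD V E).accepts : Set (List (Al V E)))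
            ((ND E c).accepts : Set (List (Al V E)))).encard
          ≤ ((E.card * (Fintype.card V - 2) : ℕ) : ℕ∞) := by
  classical
  rw [← card_PP E hord, ← Set.encard_coe_eq_coe_finsetCard]
  let φ : ((_ : {p : V × V // p ∈ E}) × V) → List (Al V E) := fun p =>
    [.vert p.2, .edge p.1, .a, .a, if c p.2 = c p.1.val.2 then .a else .b]
  refine le_trans (Set.encard_le_encard (t := φ '' (PP E : Set _)) ?_) (Set.encard_image_le _ _)
  intro w hw
  by_contra hn
  have key : MA .top w ↔ NA c .top w := by
    have kb := fun w => KR.iff (E := E) c w KR.bot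
    rcases w with _ | ⟨x, w⟩
    · simp [MA_nil, NA_nil]
    rcases x with _ | _ | v | _ <;> simp [MA_cons, NA_cons, Mstep, Nstep, kb]
    rcases w with _ | ⟨x, w⟩
    · simp [MA_nil, NA_nil]
    rcases x with _ | _ | _ | e <;> simp only [MA_cons, NA_cons, Mstep, Nstep, kb]
    have hce := hc _ e.2
    by_cases h1 : v = e.val.1
    · simp only [h1, if_true]; exact KR.iff c w (KR.smileJ 0)
    by_cases h2 : v = e.val.2
    · subst h2
      simp only [h1, if_false, if_true, hce.symm]; exact KR.iff c w (KR.frownJ 0)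
    simp only [h1, h2, if_false]
    have hw' : w ≠ [.a, .a, if c v = c e.val.2 then .a else .b] := by
      rintro rfl
      exact hn ⟨⟨e, v⟩, by simp [PP, h1, h2], rfl⟩
    split_ifs with h3 h4
    · refine half_smile c w ?_
      rwa [if_neg (by rw [h3]; exact hce)] at hw'
    · refine half_frown c w ?_
      rwa [if_pos h4] at hw'
    · refine half_smile c w ?_
      rwa [if_neg h4] at hw'
  rcases (Set.mem_symmDiff.1 hw) with ⟨h1, h2⟩ | ⟨h1, h2⟩
  · exact h2 (key.1 h1)
  · exact h2 (key.2 h1)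

def kst (V : Type) : Fin 13 → St V :=
  ![.bot, .inf, .smile, .frown, .smileJ 0, .smileJ 1, .smileJ 2, .frownJ 0, .frownJ 1, .frownJ 2,
    .halfJ 0, .halfJ 1, .halfJ 2]

theorem kst_inj {V : Type} [DecidableEq V] {E : Finset (V × V)} (i j : Fin 13)
    (h : ∀ w : List (Al V E), MA (kst V i) w ↔ MA (kst V j) w) : i = j := by
  have h0 := h []
  have h1 := h [.b]
  have h2 := h [.a]
  have h3 := h [.a, .a]
  have h4 := h [.a, .a, .a]
  have h5 := h [.a, .b]
  have h6 := h [.a, .a, .b]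
  have h7 := h [.b, .b]
  have h8 := h [.a, .a, .a, .b]
  clear h
  revert h0 h1 h2 h3 h4 h5 h6 h7 h8
  fin_cases i <;> fin_cases j <;> simp [kst, MA_nil, MA_cons, Mstep]

/-- A word reaching the state smileJ 0 from itself, pumped. -/
def loop {V : Type} {E : Finset (V × V)} : ℕ → List (Al V E) → List (Al V E)
  | 0, w => w
  | n + 1, w => .a :: .a :: .a :: .b :: .a :: loop n w

theorem loop_length {V : Type} {E : Finset (V × V)} (n : ℕ) (w : List (Al V E)) :
    n ≤ (loop n w).length := by
  induction n with
  | zero => simp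
  | succ n ih => simp [loop]; omega

theorem loop_append {V : Type} {E : Finset (V × V)} (n : ℕ) (w x : List (Al V E)) :
    loop n w ++ x = loop n (w ++ x) := by
  induction n with
  | zero => rfl
  | succ n ih => simp [loop, ih]

theorem MA_loop {V : Type} [DecidableEq V] {E : Finset (V × V)} (n : ℕ) (w : List (Al V E)) :
    MA (.smileJ 0) (loop n w) ↔ MA (.smileJ 0) w := by
  induction n with
  | zero => rfl
  | succ n ih => simpa [loop, MA_cons, Mstep] using ih

theorem MA_bot {V : Type} [DecidableEq V] {E : Finset (V × V)} (w : List (Al V E)) :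
    ¬ MA .bot w := by
  induction w with
  | nil => simp [MA_nil]
  | cons x w ih => simpa [MA_cons, Mstep] using ih

/-- words leading from smileJ 0 to the kernel states -/
def kw {V : Type} {E : Finset (V × V)} : Fin 10 → List (Al V E) :=
  ![[.b], [.a, .a, .a, .b], [.a, .a, .a], [.a, .a, .a, .b, .b, .a, .a, .a], [], [.a], [.a, .a],
    [.a, .a, .a, .b, .b], [.a, .a, .a, .b, .b, .a], [.a, .a, .a, .b, .b, .a, .a]]

theorem MA_kw {V : Type} [DecidableEq V] {E : Finset (V × V)} (i : Fin 10) (w : List (Al V E)) :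
    MA (.smileJ 0) (kw i ++ w) ↔ MA (kst V (i.castLE (by omega))) w := by
  fin_cases i <;> simp [kw, kst, MA_cons, Mstep]

theorem backward {V : Type} [Fintype V] [LinearOrder V] (E : Finset (V × V))
    (hord : ∀ e ∈ E, e.1 < e.2) (e0 : {p : V × V // p ∈ E})
    {τ : Type} [Fintype τ] (N : DFA (Al V E) τ) (hcard : Fintype.card τ ≤ 14)
    (hD : (symmDiff ((MD V E).accepts : Set (List (Al V E)))
            (N.accepts : Set (List (Al V E)))).encard
          ≤ ((E.card * (Fintype.card V - 2) : ℕ) : ℕ∞)) :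
    ∃ c : V → Fin 3, ∀ e ∈ E, c e.1 ≠ c e.2 := by
  classical
  set D := symmDiff ((MD V E).accepts : Set (List (Al V E)))
            (N.accepts : Set (List (Al V E))) with hDdef
  have hfin : D.Finite := Set.finite_of_encard_le_coe hD
  obtain ⟨B, hB⟩ : ∃ B, ∀ w ∈ D, w.length < B := by
    obtain ⟨B, hB⟩ := (hfin.image List.length).bddAbove
    exact ⟨B + 1, fun w hw => Nat.lt_succ_of_le (hB ⟨w, hw, rfl⟩)⟩
  let A : τ → List (Al V E) → Prop := fun s w => w ∈ N.acceptsFrom s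
  have A_cons : ∀ s x w, A s (x :: w) ↔ A (N.step s x) w := fun _ _ _ => Iff.rfl
  have A_app : ∀ s x w, A s (x ++ w) ↔ A (N.evalFrom s x) w := by
    intro s x w
    simp only [A, DFA.mem_acceptsFrom, DFA.evalFrom_of_append]
  have hnD : ∀ w, w ∉ D → (MA .top w ↔ A N.start w) := by
    intro w hw
    by_contra hne
    apply hw
    refine Set.mem_symmDiff.2 ?_
    change (MA .top w ∧ ¬ A N.start w) ∨ (A N.start w ∧ ¬ MA .top w)
    tauto
  have hlong : ∀ w, B ≤ w.length → (MA .top w ↔ A N.start w) :=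
    fun w hw => hnD w fun h => absurd (hB w h) (by omega)
  have h12 := (hord _ e0.2).ne
  -- kernel representatives
  let f : Fin 10 → τ := fun i =>
    N.evalFrom N.start (.vert e0.val.1 :: .edge e0 :: loop B (kw i))
  have hf : ∀ i w, A (f i) w ↔ MA (kst V (i.castLE (by omega))) w := by
    intro i w
    rw [← MA_kw, ← MA_loop B, ← loop_append]
    simp only [f]
    rw [← A_app, ← hlong]
    · simp [MA_cons, Mstep]
    · have := loop_length B (kw (E := E) i)
      simp; omega
  have f_inj : Function.Injective f := by
    intro i j hij
    have := kst_inj (E := E) (i.castLE (by omega)) (j.castLE (by omega)) (fun w => by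
      rw [← hf, ← hf, hij])
    simpa using this
  let s : V → τ := fun v => N.step N.start (.vert v)
  let W : List (Al V E) := .edge e0 :: .a :: .a :: .a :: .b :: .a :: loop B [.a, .a, .a]
  have hWl : B ≤ W.length := by
    have := loop_length B ([.a, .a, .a] : List (Al V E))
    simp [W]; omega
  have hW1 : ∀ v, A (s v) W := by
    intro v
    have : A N.start (.vert v :: W) := by
      rw [← hlong _ (by simp; omega)]
      have hl := (MA_loop (E := E) B [.a, .a, .a]).2 (by simp [MA_cons, MA_nil, Mstep])
      simp only [W, MA_cons]
      simp only [Mstep]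
      split_ifs <;> simpa [Mstep] using hl
    exact this
  have hs_start : ∀ v, s v ≠ N.start := by
    intro v hv
    have h := hW1 v
    rw [hv, ← hlong _ hWl] at h
    simp only [W, MA_cons, Mstep] at h
    exact MA_bot _ h
  -- states with a language of index i are neither start nor s v
  have hk_start : ∀ i t, (∀ w, A t w ↔ MA (kst V i) w) → t ≠ N.start := by
    rintro i t h rfl
    have h1 := (h (.vert e0.val.1 :: W)).1 (hW1 _)
    refine MA_bot W ?_
    revert h1
    fin_cases i <;> simp [kst, MA_cons, Mstep]
  have hk_s : ∀ i t, (∀ w, A t w ↔ MA (kst V i) w) → ∀ v, t ≠ s v := by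
    rintro i t h v rfl
    have h1 := (h W).1 (hW1 _)
    simp only [W, MA_cons] at h1
    generalize loop B [.a, .a, .a] = u at h1
    refine MA_bot u ?_
    revert h1
    fin_cases i <;> simp [kst, Mstep]
  -- every non-incident pair has an error
  have herr : ∀ (e : {p : V × V // p ∈ E}) (v : V), v ≠ e.val.1 → v ≠ e.val.2 →
      ∃ x, (.vert v :: .edge e :: x) ∈ D := by
    intro e v h1 h2
    by_contra hno
    push Not at hno
    let h0 : τ := N.step (s v) (.edge e)
    have H0 : ∀ w, A h0 w ↔ MA (.halfJ 0) w := by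
      intro w
      have := hnD _ (hno w)
      simp only [MA_cons, Mstep, h1, h2, if_false] at this
      exact this.symm
    have H1 : ∀ w, A (N.step h0 .a) w ↔ MA (.halfJ 1) w := by
      intro w
      rw [← A_cons, H0]; simp [MA_cons, Mstep]
    have H2 : ∀ w, A (N.step (N.step h0 .a) .a) w ↔ MA (.halfJ 2) w := by
      intro w
      rw [← A_cons, H1]; simp [MA_cons, Mstep]
    have : ∀ i : Fin 13, ∃ t, ∀ w, A t w ↔ MA (kst V i) w := by
      intro i
      by_cases hi : i.val < 10
      · exact ⟨f ⟨i, hi⟩, hf ⟨i, hi⟩⟩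
      · have : i = 10 ∨ i = 11 ∨ i = 12 := by omega
        rcases this with rfl | rfl | rfl
        exacts [⟨_, H0⟩, ⟨_, H1⟩, ⟨_, H2⟩]
    choose g hg using this
    have g_inj : Function.Injective g := by
      intro i j hij
      exact kst_inj (E := E) i j (fun w => by rw [← hg, ← hg, hij])
    let k : Option (Option (Fin 13)) → τ := fun o =>
      o.elim N.start fun o => o.elim (s v) g
    have k_inj : Function.Injective k := by
      rintro (_ | _ | i) (_ | _ | j) h
      · rfl
      · exact absurd h.symm (hs_start v)
      · exact absurd h.symm (hk_start _ _ (hg j))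
      · exact absurd h (hs_start v)
      · rfl
      · exact absurd h.symm (hk_s _ _ (hg j) v)
      · exact absurd h (hk_start _ _ (hg i))
      · exact absurd h (hk_s _ _ (hg i) v)
      · rw [g_inj h]
    have := Fintype.card_le_of_injective k k_inj
    simp at this
    omega
  -- the colouring
  let R : Finset τ := Finset.univ \ insert N.start (Finset.univ.image f)
  have hR : R.card ≤ 3 := by
    have h1 : (insert N.start (Finset.univ.image f)).card = 11 := by
      rw [Finset.card_insert_of_notMem, Finset.card_image_of_injective _ f_inj]
      · simp
      · simp only [Finset.mem_image, Finset.mem_univ, true_and, not_exists]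
        exact fun i => hk_start _ _ (hf i)
    simp only [R]
    rw [Finset.card_sdiff_of_subset (Finset.subset_univ _), h1, Finset.card_univ]
    omega
  have hsR : ∀ v, s v ∈ R := by
    intro v
    simp only [R, Finset.mem_sdiff, Finset.mem_univ, true_and, Finset.mem_insert,
      Finset.mem_image, not_or, not_exists]
    exact ⟨hs_start v, fun i => hk_s _ _ (hf i) v⟩
  obtain ⟨ι⟩ : Nonempty (R ↪ Fin 3) := by
    apply Function.Embedding.nonempty_of_card_le
    simpa using hR
  refine ⟨fun v => ι ⟨s v, hsR v⟩, ?_⟩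
  intro e he hcol
  have hss : s e.1 = s e.2 := by simpa using ι.injective hcol
  -- an extra error
  obtain ⟨v, hv, x, hx⟩ : ∃ v, (v = e.1 ∨ v = e.2) ∧
      ∃ x, (.vert v :: .edge ⟨e, he⟩ :: x) ∈ D := by
    by_contra hno
    push Not at hno
    have h := kst_inj (E := E) 4 7 (fun w => by
      have h1 := hnD _ (hno e.1 (Or.inl rfl) w)
      have h2 := hnD _ (hno e.2 (Or.inr rfl) w)
      have h3 : A N.start (.vert e.1 :: .edge ⟨e, he⟩ :: w) ↔
          A N.start (.vert e.2 :: .edge ⟨e, he⟩ :: w) := by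
        change A (N.step (s e.1) _) w ↔ A (N.step (s e.2) _) w
        rw [hss]
      rw [← h1, ← h2] at h3
      change MA (.smileJ 0) w ↔ MA (.frownJ 0) w
      simpa [MA_cons, Mstep, (hord e he).ne'] using h3)
    simp at h
  let P' := insert (⟨⟨e, he⟩, v⟩ : (_ : {p : V × V // p ∈ E}) × V) (PP E)
  have hP' : P'.card = E.card * (Fintype.card V - 2) + 1 := by
    rw [Finset.card_insert_of_notMem, card_PP E hord]
    simp only [PP, Finset.mem_sigma, Finset.mem_univ, Finset.mem_sdiff, Finset.mem_insert,
      Finset.mem_singleton, true_and, not_not]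
    exact hv
  have hall : ∀ p ∈ P', ∃ x, (.vert p.2 :: .edge p.1 :: x) ∈ D := by
    intro p hp
    rcases Finset.mem_insert.1 hp with rfl | hp
    · exact ⟨x, hx⟩
    · simp [PP] at hp
      exact herr _ _ hp.1 hp.2
  choose! y hy using hall
  have hle : (P' : Set ((_ : {p : V × V // p ∈ E}) × V)).encard ≤ D.encard := by
    apply Set.encard_le_encard_of_injOn (f := fun p => .vert p.2 :: .edge p.1 :: y p)
    · exact fun p hp => hy p hp
    · rintro ⟨p1, p2⟩ _ ⟨q1, q2⟩ _ h
      simp at h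
      obtain ⟨rfl, rfl, _⟩ := h
      rfl
  rw [Set.encard_coe_eq_coe_finsetCard, hP'] at hle
  have := hle.trans hD
  rw [Nat.cast_le] at this
  omega

/-- There is a DFA `N` with at most 14 states committing at most `|E|·(|V|−2)` errors
with respect to `M` if and only if `G` is 3-colourable. -/
theorem errorBounded_hyperMin_iff_threeColourable
    {V : Type} [Fintype V] [LinearOrder V] (E : Finset (V × V))
    (hord : ∀ e ∈ E, e.1 < e.2)
    (hinc : ∀ v : V, ∃ e ∈ E, v = e.1 ∨ v = e.2) :
    (∃ (τ : Type) (_ : Fintype τ) (N : DFA (Al V E) τ),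
        Fintype.card τ ≤ 14 ∧
        (symmDiff ((MD V E).accepts : Set (List (Al V E)))
            (N.accepts : Set (List (Al V E)))).encard
          ≤ ((E.card * (Fintype.card V - 2) : ℕ) : ℕ∞)) ↔
      ∃ c : V → Fin 3, ∀ e ∈ E, c e.1 ≠ c e.2 := by
  constructor
  · rintro ⟨τ, hτ, N, hcard, hD⟩
    by_cases hE : E.Nonempty
    · obtain ⟨e, he⟩ := hE
      exact backward E hord ⟨e, he⟩ N hcard hD
    · refine ⟨fun _ => 0, fun e he => absurd ⟨e, he⟩ hE⟩
  · rintro ⟨c, hc⟩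
    exact ⟨NS, inferInstance, ND E c, card_NS.le, forward E hord c hc⟩
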